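/- Let d ≥ 3. There exist β ≥ 1, K > 1 and ρ ∈ (0,1), depending only on d, such that for every past matrix N (i.e., every finite product of the matrices B₁ and B₂, including the identity): p({v ∈ Ω₁ : there exists n ≥ 0 such that N·M(v,n) is β-balanced and C_max(N·M(v,n)) ≤ K·C_max(N)} | N) ≥ ρ. In words: regardless of the past, with conditional probability at least ρ the matrix of the Selmer algorithm becomes β-balanced before its largest column sum increases by a factor of K. -/

import Mathlib

open MeasureTheory

noncomputable section

/-- The cone `Ω = {x ∈ ℝ^d : 0 ≤ x[1] ≤ … ≤ x[d] ≤ x[1]+x[2]}` intersected with the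
hyperplane `{x : x[1]+⋯+x[d] = 1}`, i.e. `Ω₁`, for `d = m + 3`, inside Euclidean space. -/
def selmerSimplexE (m : ℕ) : Set (EuclideanSpace ℝ (Fin (m + 3))) :=
  {x | 0 ≤ x 0 ∧ (∀ i j : Fin (m + 3), i ≤ j → x i ≤ x j) ∧
    x (Fin.last (m + 2)) ≤ x 0 + x 1 ∧ ∑ i, x i = 1}

/-- The restricted Selmer map `S : Ω → Ω`:
`S(x) = (x[1], x[d]−x[1], x[2], …, x[d−1])` if `x[d] ≥ 2x[1]`, and
`S(x) = (x[d]−x[1], x[1], x[2], …, x[d−1])` otherwise. -/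
def selmerS (m : ℕ) (x : Fin (m + 3) → ℝ) : Fin (m + 3) → ℝ := fun i =>
  if (i : ℕ) = 0 then
    (if 2 * x 0 ≤ x (Fin.last (m + 2)) then x 0 else x (Fin.last (m + 2)) - x 0)
  else if (i : ℕ) = 1 then
    (if 2 * x 0 ≤ x (Fin.last (m + 2)) then x (Fin.last (m + 2)) - x 0 else x 0)
  else x ⟨(i : ℕ) - 1, by have := i.isLt; omega⟩

/-- The matrix `B₁`, acting by `B₁y = (y[1], y[3], y[4], …, y[d], y[1]+y[2])`, so that
`B₁·S(x) = x` when `x[d] ≥ 2x[1]`. -/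
def selmerB1 (m : ℕ) : Matrix (Fin (m + 3)) (Fin (m + 3)) ℝ :=
  Matrix.of fun i j =>
    if (i : ℕ) = 0 then (if (j : ℕ) = 0 then 1 else 0)
    else if (i : ℕ) = m + 2 then (if (j : ℕ) ≤ 1 then 1 else 0)
    else if (j : ℕ) = (i : ℕ) + 1 then 1 else 0

/-- The matrix `B₂`, acting by `B₂y = (y[2], y[3], y[4], …, y[d], y[1]+y[2])`, so that
`B₂·S(x) = x` when `x[d] < 2x[1]`. -/
def selmerB2 (m : ℕ) : Matrix (Fin (m + 3)) (Fin (m + 3)) ℝ :=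
  Matrix.of fun i j =>
    if (i : ℕ) = 0 then (if (j : ℕ) = 1 then 1 else 0)
    else if (i : ℕ) = m + 2 then (if (j : ℕ) ≤ 1 then 1 else 0)
    else if (j : ℕ) = (i : ℕ) + 1 then 1 else 0

/-- The one-step matrix `B_{ι(x)}`, where `ι(x) = 1` if `x[d] ≥ 2x[1]` and `ι(x) = 2`
otherwise. -/
def selmerStep (m : ℕ) (x : Fin (m + 3) → ℝ) : Matrix (Fin (m + 3)) (Fin (m + 3)) ℝ :=
  if 2 * x 0 ≤ x (Fin.last (m + 2)) then selmerB1 m else selmerB2 m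

/-- The matrix of induction `M(x,n) = B_{ι(x)}·B_{ι(S(x))}···B_{ι(S^{n−1}(x))}`
(with `M(x,0) = Id`), so that `M(x,n)·Sⁿ(x) = x`. -/
def selmerMat (m : ℕ) (x : Fin (m + 3) → ℝ) : ℕ → Matrix (Fin (m + 3)) (Fin (m + 3)) ℝ
  | 0 => 1
  | n + 1 => selmerMat m x n * selmerStep m ((selmerS m)^[n] x)

/-- The `j`-th column sum `C_j(N)` of a matrix. -/
def colSum (m : ℕ) (N : Matrix (Fin (m + 3)) (Fin (m + 3)) ℝ) (j : Fin (m + 3)) : ℝ :=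
  ∑ i, N i j

/-- The largest column sum `C_max(N)` of a matrix. -/
def colMax (m : ℕ) (N : Matrix (Fin (m + 3)) (Fin (m + 3)) ℝ) : ℝ :=
  ⨆ j, colSum m N j

/-- `N` is `β`-balanced if `β·C_j(N) ≥ C_max(N)` for every `j`. -/
def IsBalanced (m : ℕ) (β : ℝ) (N : Matrix (Fin (m + 3)) (Fin (m + 3)) ℝ) : Prop :=
  ∀ j, colMax m N ≤ β * colSum m N j

/-- The conditional probability of `U ⊆ Ω₁` given the past matrix `N`:
`p(U|N) = (∫_U (C₁v[1]+⋯+C_d v[d])^{−d} dλ₀) / (∫_{Ω₁} (C₁v[1]+⋯+C_d v[d])^{−d} dλ₀)`,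
where `C_j = C_j(N)` and `λ₀` is the `(d−1)`-dimensional Hausdorff measure. -/
def selmerCondP (m : ℕ) (N : Matrix (Fin (m + 3)) (Fin (m + 3)) ℝ)
    (U : Set (EuclideanSpace ℝ (Fin (m + 3)))) : ℝ :=
  (∫ v in U, ((∑ j, colSum m N j * v j) ^ (m + 3))⁻¹ ∂(μH[(m + 2 : ℝ)])) /
    (∫ v in selmerSimplexE m, ((∑ j, colSum m N j * v j) ^ (m + 3))⁻¹ ∂(μH[(m + 2 : ℝ)]))

end

section SelmerDynamics

variable {m : ℕ}

lemma selmerB1_mulVec_zero (y : Fin (m + 3) → ℝ) : (selmerB1 m).mulVec y 0 = y 0 := by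
  simp only [Matrix.mulVec, dotProduct, selmerB1, Matrix.of_apply]
  rw [Finset.sum_eq_single 0]
  · simp
  · intro b _ hb
    have : (b : ℕ) ≠ 0 := fun h => hb (Fin.ext h)
    simp [this]
  · simp

lemma selmerB2_mulVec_zero (y : Fin (m + 3) → ℝ) : (selmerB2 m).mulVec y 0 = y 1 := by
  simp only [Matrix.mulVec, dotProduct, selmerB2, Matrix.of_apply]
  rw [Finset.sum_eq_single 1]
  · simp
  · intro b _ hb
    have : (b : ℕ) ≠ 1 := fun h => hb (Fin.ext (by simpa using h))
    simp [this]
  · simp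

lemma selmerB1_mulVec_mid (y : Fin (m + 3) → ℝ) (i : ℕ) (h0 : 0 < i) (h : i < m + 2) :
    (selmerB1 m).mulVec y ⟨i, by omega⟩ = y ⟨i + 1, by omega⟩ := by
  simp only [Matrix.mulVec, dotProduct, selmerB1, Matrix.of_apply]
  rw [Finset.sum_eq_single ⟨i + 1, by omega⟩]
  · simp [h0.ne', h.ne]
  · intro b _ hb
    have : (b : ℕ) ≠ i + 1 := fun h => hb (Fin.ext (by simpa using h))
    simp [this, h0.ne', h.ne]
  · simp

lemma selmerB2_mulVec_mid (y : Fin (m + 3) → ℝ) (i : ℕ) (h : i < m + 2) :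
    (selmerB2 m).mulVec y ⟨i, by omega⟩ = y ⟨i + 1, by omega⟩ := by
  rcases Nat.eq_zero_or_pos i with rfl | h0
  · exact selmerB2_mulVec_zero y
  simp only [Matrix.mulVec, dotProduct, selmerB2, Matrix.of_apply]
  rw [Finset.sum_eq_single ⟨i + 1, by omega⟩]
  · simp [h0.ne', h.ne]
  · intro b _ hb
    have : (b : ℕ) ≠ i + 1 := fun h => hb (Fin.ext (by simpa using h))
    simp [this, h0.ne', h.ne]
  · simp

lemma sum_le_one_aux (y : Fin (m + 3) → ℝ) :
    ∑ j : Fin (m + 3), (if (j : ℕ) ≤ 1 then (1 : ℝ) else 0) * y j = y 0 + y 1 := by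
  rw [Fin.sum_univ_succ, Fin.sum_univ_succ]
  simp

lemma selmerB1_mulVec_last (y : Fin (m + 3) → ℝ) :
    (selmerB1 m).mulVec y (Fin.last (m + 2)) = y 0 + y 1 := by
  simp only [Matrix.mulVec, dotProduct, selmerB1, Matrix.of_apply]
  rw [← sum_le_one_aux]
  simp

lemma selmerB2_mulVec_last (y : Fin (m + 3) → ℝ) :
    (selmerB2 m).mulVec y (Fin.last (m + 2)) = y 0 + y 1 := by
  simp only [Matrix.mulVec, dotProduct, selmerB2, Matrix.of_apply]
  rw [← sum_le_one_aux]
  simp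

/-- index decomposition -/
lemma fin_cases3 (i : Fin (m + 3)) :
    i = 0 ∨ (∃ k : ℕ, ∃ _ : 0 < k, ∃ h : k < m + 2, i = ⟨k, by omega⟩) ∨ i = Fin.last (m + 2) := by
  rcases Nat.eq_zero_or_pos (i : ℕ) with h | h
  · exact Or.inl (Fin.ext h)
  · rcases Nat.lt_or_ge (i : ℕ) (m + 2) with h2 | h2
    · exact Or.inr (Or.inl ⟨i, h, h2, rfl⟩)
    · refine Or.inr (Or.inr (Fin.ext ?_))
      have := i.isLt
      simp only [Fin.val_last]
      omega

/-- left recursion for the matrix of induction -/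
lemma selmerMat_add (x : Fin (m + 3) → ℝ) (a b : ℕ) :
    selmerMat m x (a + b) = selmerMat m x a * selmerMat m ((selmerS m)^[a] x) b := by
  induction b with
  | zero => simp [selmerMat]
  | succ b ih =>
    rw [← add_assoc]
    simp only [selmerMat]
    rw [ih, Matrix.mul_assoc, ← Function.iterate_add_apply, Nat.add_comm b a]

lemma selmerMat_one (x : Fin (m + 3) → ℝ) : selmerMat m x 1 = selmerStep m x := by
  simp [selmerMat]

lemma selmerMat_succ' (x : Fin (m + 3) → ℝ) (n : ℕ) :
    selmerMat m x (n + 1) = selmerStep m x * selmerMat m (selmerS m x) n := by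
  rw [Nat.add_comm n 1, selmerMat_add, selmerMat_one]; rfl

/-- B1 branch -/
lemma selmer_B1_branch (y : Fin (m + 3) → ℝ) (h : y 0 ≤ y 1) :
    selmerS m ((selmerB1 m).mulVec y) = y ∧
      selmerStep m ((selmerB1 m).mulVec y) = selmerB1 m := by
  have hc : 2 * (selmerB1 m).mulVec y 0 ≤ (selmerB1 m).mulVec y (Fin.last (m + 2)) := by
    rw [selmerB1_mulVec_zero, selmerB1_mulVec_last]; linarith
  constructor
  · funext i
    simp only [selmerS, if_pos hc]
    split_ifs with h0 h1
    · rw [selmerB1_mulVec_zero]; congr 1; exact (Fin.ext h0).symm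
    · rw [selmerB1_mulVec_last, selmerB1_mulVec_zero]
      have : i = 1 := Fin.ext (by simpa using h1)
      rw [this]; ring
    · have := i.isLt
      rw [selmerB1_mulVec_mid y ((i : ℕ) - 1) (by omega) (by omega)]
      congr 1
      apply Fin.ext
      simp only
      omega
  · simp only [selmerStep, if_pos hc]

lemma selmerB1_pow_branch (y : Fin (m + 3) → ℝ) (h0 : 0 ≤ y 0) (h : ∀ i, y 0 ≤ y i) (n : ℕ) :
    (selmerS m)^[n] ((selmerB1 m ^ n).mulVec y) = y ∧
      selmerMat m ((selmerB1 m ^ n).mulVec y) n = selmerB1 m ^ n ∧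
      ((selmerB1 m ^ n).mulVec y) 0 = y 0 ∧
      ∀ i, y 0 ≤ ((selmerB1 m ^ n).mulVec y) i := by
  induction n with
  | zero => simp [selmerMat, h]
  | succ n ih =>
    obtain ⟨i1, i2, i3, i4⟩ := ih
    have e : (selmerB1 m ^ (n + 1)).mulVec y =
        (selmerB1 m).mulVec ((selmerB1 m ^ n).mulVec y) := by
      rw [Matrix.mulVec_mulVec, pow_succ']
    obtain ⟨b1, b2⟩ := selmer_B1_branch ((selmerB1 m ^ n).mulVec y) (by rw [i3]; exact i4 1)
    rw [e]
    refine ⟨?_, ?_, ?_, ?_⟩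
    · rw [Function.iterate_succ_apply, b1, i1]
    · rw [selmerMat_succ', b1, b2, i2, pow_succ']
    · rw [selmerB1_mulVec_zero, i3]
    · intro i
      rcases fin_cases3 i with rfl | ⟨k, hk0, hk, rfl⟩ | rfl
      · rw [selmerB1_mulVec_zero]; exact i4 0
      · rw [selmerB1_mulVec_mid _ k hk0 hk]; exact i4 _
      · rw [selmerB1_mulVec_last, i3]; linarith [i4 1]

/-- shift: add `q * x 0` to all coordinates but the first one. -/
def selmerShift (m : ℕ) (q : ℕ) (x : Fin (m + 3) → ℝ) : Fin (m + 3) → ℝ := fun i =>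
  if i = 0 then x 0 else x i + q * x 0

/-- auxiliary sequence -/
def selmerZ1 (m : ℕ) (y : Fin (m + 3) → ℝ) (i : ℕ) : ℝ :=
  y ⟨1 + i % (m + 2), by have := Nat.mod_lt i (show 0 < m + 2 by omega); omega⟩ +
    ((i / (m + 2) : ℕ) : ℝ) * y 0

lemma selmerZ1_add (y : Fin (m + 3) → ℝ) (i : ℕ) :
    selmerZ1 m y (i + (m + 2)) = selmerZ1 m y i + y 0 := by
  have h1 : (i + (m + 2)) % (m + 2) = i % (m + 2) := Nat.add_mod_right _ _
  have h2 : (i + (m + 2)) / (m + 2) = i / (m + 2) + 1 := Nat.add_div_right _ (by omega)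
  simp only [selmerZ1, h1, h2]
  push_cast; ring

lemma selmerB1_pow_formula (y : Fin (m + 3) → ℝ) (n : ℕ) :
    (selmerB1 m ^ n).mulVec y 0 = y 0 ∧
    ∀ i (h : i < m + 2), (selmerB1 m ^ n).mulVec y ⟨i + 1, by omega⟩ = selmerZ1 m y (n + i) := by
  induction n with
  | zero =>
    refine ⟨by simp, fun i h => ?_⟩
    simp only [pow_zero, Matrix.one_mulVec, selmerZ1, Nat.zero_add, Nat.mod_eq_of_lt h,
      Nat.div_eq_of_lt h]
    simp [Nat.add_comm]
  | succ n ih =>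
    have e : (selmerB1 m ^ (n + 1)).mulVec y =
        (selmerB1 m).mulVec ((selmerB1 m ^ n).mulVec y) := by
      rw [Matrix.mulVec_mulVec, pow_succ']
    rw [e]
    refine ⟨by rw [selmerB1_mulVec_zero, ih.1], fun i h => ?_⟩
    rcases Nat.lt_or_ge (i + 1) (m + 2) with h2 | h2
    · rw [selmerB1_mulVec_mid _ (i + 1) (by omega) h2, ih.2 (i + 1) h2]
      congr 1; omega
    · have hi : i = m + 1 := by omega
      subst hi
      have := selmerB1_mulVec_last ((selmerB1 m ^ n).mulVec y)
      rw [ih.1] at this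
      have e1 := ih.2 0 (by omega)
      have e2 : (⟨0 + 1, by omega⟩ : Fin (m + 3)) = 1 := Fin.ext (by simp)
      rw [e2] at e1
      rw [e1] at this
      have e3 : (⟨m + 1 + 1, by omega⟩ : Fin (m + 3)) = Fin.last (m + 2) := Fin.ext (by simp)
      rw [e3, this]
      have := selmerZ1_add y n
      rw [show n + 1 + (m + 1) = n + (m + 2) by omega, this, Nat.add_zero n]; ring

lemma selmerB1_pow_shift (y : Fin (m + 3) → ℝ) (q : ℕ) :
    (selmerB1 m ^ ((m + 2) * q)).mulVec y = selmerShift m q y := by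
  funext i
  obtain ⟨h1, h2⟩ := selmerB1_pow_formula y ((m + 2) * q)
  rcases Nat.eq_zero_or_pos (i : ℕ) with h | h
  · have : i = 0 := Fin.ext h
    subst this
    simp [selmerShift, h1]
  · have hl := i.isLt
    have := h2 ((i : ℕ) - 1) (by omega)
    have e : (⟨(i : ℕ) - 1 + 1, by omega⟩ : Fin (m + 3)) = i := Fin.ext (by simp only; omega)
    rw [e] at this
    rw [this]
    have hne : i ≠ 0 := fun h' => by rw [h'] at h; simp at h
    have a1 : ((m + 2) * q + ((i : ℕ) - 1)) % (m + 2) = (i : ℕ) - 1 := by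
      rw [Nat.mul_add_mod]; exact Nat.mod_eq_of_lt (by omega)
    have a2 : ((m + 2) * q + ((i : ℕ) - 1)) / (m + 2) = q := by
      rw [Nat.mul_add_div (by omega), Nat.div_eq_of_lt (by omega : (i : ℕ) - 1 < m + 2), Nat.add_zero]
    simp only [selmerZ1, a1, a2, selmerShift, if_neg hne]
    congr 2
    apply Fin.ext
    simp only
    omega

/-- The open cone. -/
def selmerG (m : ℕ) : Set (Fin (m + 3) → ℝ) :=
  {x | 0 < x 0 ∧ (∀ i : Fin (m + 2), x i.castSucc < x i.succ) ∧
    x (Fin.last (m + 2)) < x 0 + x 1}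

/-- inverse branch of B2 -/
def selmerL (m : ℕ) (x : Fin (m + 3) → ℝ) : Fin (m + 3) → ℝ := fun i =>
  if (i : ℕ) = 0 then x (Fin.last (m + 2)) - x 0
  else x ⟨(i : ℕ) - 1, by have := i.isLt; omega⟩

/-- iterated cylinders -/
def selmerW (m : ℕ) : ℕ → Set (Fin (m + 3) → ℝ)
  | 0 => selmerG m
  | n + 1 => (selmerL m) ⁻¹' (selmerW m n)

lemma selmerL_cont : Continuous (selmerL m) := by
  apply continuous_pi
  intro i
  unfold selmerL
  split_ifs <;> fun_prop

lemma selmerG_open : IsOpen (selmerG m) := by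
  have : selmerG m = {x | 0 < x 0} ∩ ((⋂ i : Fin (m + 2), {x | x i.castSucc < x i.succ}) ∩
    {x | x (Fin.last (m + 2)) < x 0 + x 1}) := by
    ext x; simp [selmerG]
  rw [this]
  refine IsOpen.inter (isOpen_lt (by fun_prop) (by fun_prop)) (IsOpen.inter ?_
    (isOpen_lt (by fun_prop) (by fun_prop)))
  exact isOpen_iInter_of_finite fun i => isOpen_lt (by fun_prop) (by fun_prop)

lemma selmerW_open (n : ℕ) : IsOpen (selmerW m n) := by
  induction n with
  | zero => exact selmerG_open
  | succ n ih => exact ih.preimage selmerL_cont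

lemma selmerL_smul (c : ℝ) (x : Fin (m + 3) → ℝ) : selmerL m (c • x) = c • selmerL m x := by
  funext i
  simp only [selmerL, Pi.smul_apply, smul_eq_mul]
  split_ifs <;> ring

lemma selmerW_smul (n : ℕ) (c : ℝ) (hc : 0 < c) (x : Fin (m + 3) → ℝ) (hx : x ∈ selmerW m n) :
    c • x ∈ selmerW m n := by
  induction n generalizing x with
  | zero =>
    obtain ⟨h1, h2, h3⟩ := hx
    refine ⟨?_, fun i => ?_, ?_⟩
    · simpa using mul_pos hc h1
    · simpa using mul_lt_mul_of_pos_left (h2 i) hc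
    · have := mul_lt_mul_of_pos_left h3 hc
      simpa [mul_add] using this
  | succ n ih =>
    change selmerL m (c • x) ∈ selmerW m n
    rw [selmerL_smul]
    exact ih _ hx

lemma selmerG_of_L (x : Fin (m + 3) → ℝ) (h : selmerL m x ∈ selmerG m) : x ∈ selmerG m := by
  obtain ⟨h1, h2, h3⟩ := h
  have L0 : selmerL m x 0 = x (Fin.last (m + 2)) - x 0 := by simp [selmerL]
  have Ls : ∀ i : ℕ, ∀ h : i < m + 2, selmerL m x ⟨i + 1, by omega⟩ = x ⟨i, by omega⟩ := by
    intro i h; simp [selmerL]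
  have k : ∀ i : ℕ, ∀ h : i + 1 < m + 2, x ⟨i, by omega⟩ < x ⟨i + 1, by omega⟩ := by
    intro i h
    have := h2 ⟨i + 1, h⟩
    have e1 := Ls i (by omega)
    have e2 := Ls (i + 1) (by omega)
    rw [← e1, ← e2]; exact this
  have l01 := h2 0
  have e01 : selmerL m x 1 = x 0 := Ls 0 (by omega)
  have elast : selmerL m x (Fin.last (m + 2)) = x ⟨m + 1, by omega⟩ := Ls (m + 1) (by omega)
  have e02 : selmerL m x ⟨2, by omega⟩ = x 1 := Ls 1 (by omega)
  have l12 : selmerL m x 1 < selmerL m x ⟨2, by omega⟩ := h2 1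
  have l01' : selmerL m x 0 < selmerL m x 1 := h2 0
  rw [L0] at h1 l01' h3
  rw [e01] at l01' l12 h3
  rw [e02] at l12
  rw [elast] at h3
  refine ⟨by linarith, fun i => ?_, by linarith⟩
  rcases Nat.lt_or_ge ((i : ℕ) + 1) (m + 2) with hi | hi
  · exact k i hi
  · have hl := i.isLt
    have : i = ⟨m + 1, Nat.lt_succ_self _⟩ := Fin.ext (by simp only; omega)
    rw [this]
    change x ⟨m + 1, by omega⟩ < x (Fin.last (m + 2))
    linarith

lemma selmerW_sub_G (n : ℕ) : selmerW m n ⊆ selmerG m := by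
  induction n with
  | zero => exact subset_rfl
  | succ n ih => exact fun x hx => selmerG_of_L x (ih hx)

lemma selmerL_B2 (y : Fin (m + 3) → ℝ) : selmerL m ((selmerB2 m).mulVec y) = y := by
  funext i
  simp only [selmerL]
  split_ifs with h
  · rw [selmerB2_mulVec_last, selmerB2_mulVec_zero]
    have : i = 0 := Fin.ext h
    rw [this]; ring
  · have := i.isLt
    rw [selmerB2_mulVec_mid y ((i : ℕ) - 1) (by omega)]
    congr 1
    apply Fin.ext
    simp only
    omega

lemma selmerW_mat (n : ℕ) (x : Fin (m + 3) → ℝ) (hx : x ∈ selmerW m n) :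
    selmerMat m x n = selmerB2 m ^ n := by
  induction n generalizing x with
  | zero => simp [selmerMat]
  | succ n ih =>
    have hL : selmerL m x ∈ selmerW m n := hx
    obtain ⟨h1, h2, h3⟩ := selmerW_sub_G n hL
    have h01 : selmerL m x 0 < selmerL m x 1 := h2 0
    have e0 : selmerL m x 0 = x (Fin.last (m + 2)) - x 0 := by simp [selmerL]
    have e1 : selmerL m x 1 = x 0 := by simp [selmerL]
    rw [e0, e1] at h01
    have hc : ¬ (2 * x 0 ≤ x (Fin.last (m + 2))) := by linarith
    have hS : selmerS m x = selmerL m x := by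
      funext i
      simp only [selmerS, selmerL, if_neg hc]
      split_ifs with a b
      · rfl
      · congr 1; apply Fin.ext; simp [b]
      · rfl
    rw [selmerMat_succ', hS, ih _ hL, pow_succ']
    simp [selmerStep, hc]

lemma selmerW_nonempty (n : ℕ) : (selmerW m n).Nonempty := by
  induction n with
  | zero =>
    refine ⟨fun i => (m : ℝ) + 3 + (i : ℕ), ?_, fun i => ?_, ?_⟩
    · positivity
    · simp
    · simp; linarith
  | succ n ih =>
    obtain ⟨y, hy⟩ := ih
    refine ⟨(selmerB2 m).mulVec y, ?_⟩
    change selmerL m _ ∈ selmerW m n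
    rwa [selmerL_B2]

/-- Positivity of a power of B2. -/
lemma selmerB2_nonneg (i j : Fin (m + 3)) : 0 ≤ selmerB2 m i j := by
  simp only [selmerB2, Matrix.of_apply]; split_ifs <;> norm_num

lemma selmerB2_pow_seq (y : Fin (m + 3) → ℝ) (i : ℕ) (h : i < m + 3) (n : ℕ) :
    (selmerB2 m ^ n).mulVec y ⟨i, h⟩ = (selmerB2 m ^ (n + i)).mulVec y 0 := by
  induction i generalizing n with
  | zero => rfl
  | succ i ih =>
    have := ih (by omega) (n + 1)
    rw [show n + (i + 1) = n + 1 + i by omega, ← this, pow_succ', ← Matrix.mulVec_mulVec,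
      selmerB2_mulVec_mid _ i (by omega)]

lemma selmerB2_pow_rec (y : Fin (m + 3) → ℝ) (n : ℕ) :
    (selmerB2 m ^ (n + (m + 3))).mulVec y 0 =
      (selmerB2 m ^ n).mulVec y 0 + (selmerB2 m ^ (n + 1)).mulVec y 0 := by
  have h1 := selmerB2_pow_seq y (m + 2) (by omega) (n + 1)
  rw [show n + 1 + (m + 2) = n + (m + 3) by omega] at h1
  rw [← h1, pow_succ' (n := n), ← Matrix.mulVec_mulVec]
  have := selmerB2_mulVec_last ((selmerB2 m ^ n).mulVec y)
  rw [show (⟨m + 2, by omega⟩ : Fin (m + 3)) = Fin.last (m + 2) from rfl, this,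
    selmerB2_mulVec_zero]

lemma selmer_seq_pos (z : ℕ → ℝ) (hz0 : ∀ n, 0 ≤ z n)
    (hz : ∀ n, z (n + (m + 3)) = z n + z (n + 1)) (j : ℕ) (hj : j < m + 3) (hzj : 0 < z j) :
    ∀ i, (m + 3) * (m + 3) ≤ i → 0 < z i := by
  have key : ∀ i0, 1 ≤ i0 → 0 < z i0 → ∀ n t, t ≤ n → 0 < z (i0 + n * (m + 2) + t) := by
    intro i0 hi0 hz1 n
    induction n with
    | zero => intro t ht; simpa [Nat.le_zero.mp ht] using hz1
    | succ n ih =>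
      intro t ht
      rcases Nat.lt_or_ge n t with h | h
      · have h1 := ih n le_rfl
        have e : i0 + (n + 1) * (m + 2) + t = (i0 + n * (m + 2) + n) + (m + 3) := by
          have : t = n + 1 := by omega
          subst this; ring
        rw [e, hz]
        linarith [hz0 (i0 + n * (m + 2) + n + 1)]
      · have h1 := ih t h
        have e : i0 + (n + 1) * (m + 2) + t = (i0 + n * (m + 2) + t - 1) + (m + 3) := by
          have : (n + 1) * (m + 2) = n * (m + 2) + (m + 2) := by ring
          omega
        have e2 : i0 + n * (m + 2) + t - 1 + 1 = i0 + n * (m + 2) + t := by omega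
        rw [e, hz, e2]
        linarith [hz0 (i0 + n * (m + 2) + t - 1)]
  obtain ⟨i0, h1, h2, h3⟩ : ∃ i0, 1 ≤ i0 ∧ i0 ≤ m + 3 ∧ 0 < z i0 := by
    rcases Nat.eq_zero_or_pos j with rfl | h
    · refine ⟨m + 3, by omega, le_rfl, ?_⟩
      have := hz 0
      rw [Nat.zero_add] at this
      rw [this]; linarith [hz0 (0 + 1)]
    · exact ⟨j, h, hj.le, hzj⟩
  intro i hi
  have hle : m + 3 ≤ (i - i0) / (m + 2) := by
    rw [Nat.le_div_iff_mul_le (by omega)]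
    have : (m + 3) * (m + 3) = (m + 3) * (m + 2) + (m + 3) := by ring
    omega
  have hm := Nat.mod_lt (i - i0) (show 0 < m + 2 by omega)
  have := key i0 h1 h3 ((i - i0) / (m + 2)) ((i - i0) % (m + 2)) (by omega)
  have e : i0 + (i - i0) / (m + 2) * (m + 2) + (i - i0) % (m + 2) = i := by
    have := Nat.div_add_mod' (i - i0) (m + 2)
    have : m + 3 ≤ (m + 3) * (m + 3) := Nat.le_mul_of_pos_left _ (by omega)
    omega
  rwa [e] at this

lemma selmerB2_pow_nonneg (n : ℕ) (i j : Fin (m + 3)) : 0 ≤ (selmerB2 m ^ n) i j := by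
  induction n generalizing i j with
  | zero => simp only [pow_zero, Matrix.one_apply]; split_ifs <;> norm_num
  | succ n ih =>
    rw [pow_succ, Matrix.mul_apply]
    exact Finset.sum_nonneg fun k _ => mul_nonneg (ih i k) (selmerB2_nonneg k j)

lemma selmerB2_pow_pos (i j : Fin (m + 3)) :
    0 < (selmerB2 m ^ ((m + 3) * (m + 3))) i j := by
  have e : ∀ n i, (selmerB2 m ^ n) i j = (selmerB2 m ^ n).mulVec (Pi.single j 1) i := by
    intro n i; simp
  rw [e]
  have := selmerB2_pow_seq (Pi.single j 1) i i.isLt ((m + 3) * (m + 3))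
  rw [Fin.eta] at this
  rw [this]
  refine selmer_seq_pos (m := m) (fun n => (selmerB2 m ^ n).mulVec (Pi.single j 1) 0) ?_ ?_ j
    j.isLt ?_ _ (by omega)
  · intro n; rw [← e]; exact selmerB2_pow_nonneg n 0 j
  · intro n; exact selmerB2_pow_rec _ n
  · have := selmerB2_pow_seq (Pi.single j 1) j j.isLt 0
    rw [Nat.zero_add] at this
    rw [← this]; simp

/-- column sums -/
lemma colSum_mul (N B : Matrix (Fin (m + 3)) (Fin (m + 3)) ℝ) (j : Fin (m + 3)) :
    colSum m (N * B) j = ∑ k, colSum m N k * B k j := by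
  simp only [colSum, Matrix.mul_apply, Finset.sum_mul]
  exact Finset.sum_comm

lemma colSum_le_colMax (N : Matrix (Fin (m + 3)) (Fin (m + 3)) ℝ) (j : Fin (m + 3)) :
    colSum m N j ≤ colMax m N :=
  le_ciSup (Set.finite_range _).bddAbove j

lemma colMax_le (N : Matrix (Fin (m + 3)) (Fin (m + 3)) ℝ) (c : ℝ) (h : ∀ j, colSum m N j ≤ c) :
    colMax m N ≤ c := ciSup_le h

lemma colSum_pos (N : Matrix (Fin (m + 3)) (Fin (m + 3)) ℝ)
    (hN : N ∈ Submonoid.closure {selmerB1 m, selmerB2 m}) : ∀ j, 0 < colSum m N j := by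
  have aux : ∀ N B : Matrix (Fin (m + 3)) (Fin (m + 3)) ℝ, (∀ j, 0 < colSum m N j) →
      (∀ i j, 0 ≤ B i j) → (∀ j, ∃ i, 0 < B i j) → ∀ j, 0 < colSum m (N * B) j := by
    intro N B hN h0 h1 j
    rw [colSum_mul]
    obtain ⟨i, hi⟩ := h1 j
    exact Finset.sum_pos' (fun k _ => mul_nonneg (hN k).le (h0 k j))
      ⟨i, Finset.mem_univ _, mul_pos (hN i) hi⟩
  induction hN using Submonoid.closure_induction_right with
  | one => intro j; simp [colSum, Matrix.one_apply]
  | mul_right N hN B hB ih =>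
    have hB' : B = selmerB1 m ∨ B = selmerB2 m := hB
    refine aux N B ih ?_ ?_
    · intro i j
      rcases hB' with rfl | rfl
      · simp only [selmerB1, Matrix.of_apply]; split_ifs <;> norm_num
      · exact selmerB2_nonneg i j
    · intro j
      have hl := j.isLt
      rcases Nat.lt_or_ge 1 (j : ℕ) with hj | hj
      · refine ⟨⟨(j : ℕ) - 1, by omega⟩, ?_⟩
        have a1 : ¬ ((j : ℕ) - 1 = 0) := by omega
        have a2 : ¬ ((j : ℕ) - 1 = m + 2) := by omega
        have a3 : (j : ℕ) = (j : ℕ) - 1 + 1 := by omega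
        rcases hB' with rfl | rfl
        · simp only [selmerB1, Matrix.of_apply, if_neg a1, if_neg a2, if_pos a3]; norm_num
        · simp only [selmerB2, Matrix.of_apply, if_neg a1, if_neg a2, if_pos a3]; norm_num
      · refine ⟨Fin.last (m + 2), ?_⟩
        rcases hB' with rfl | rfl
        · simp [selmerB1, hj]
        · simp [selmerB2, hj]

lemma colSum_B1_pow (N : Matrix (Fin (m + 3)) (Fin (m + 3)) ℝ) (q : ℕ) (j : Fin (m + 3)) :
    colSum m (N * selmerB1 m ^ ((m + 2) * q)) j =
      colSum m N j + if j = 0 then q * ∑ k : Fin (m + 2), colSum m N k.succ else 0 := by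
  rw [colSum_mul]
  have e : ∀ k, (selmerB1 m ^ ((m + 2) * q)) k j = selmerShift m q (Pi.single j 1) k := by
    intro k; rw [← selmerB1_pow_shift]; simp
  simp only [e, selmerShift]
  rw [Fin.sum_univ_succ]
  simp only [Fin.succ_ne_zero, if_true, if_false]
  rcases Fin.eq_zero_or_eq_succ j with rfl | ⟨j', rfl⟩
  · simp [Finset.mul_sum, mul_comm]
  · simp [Pi.single_apply, (Fin.succ_ne_zero j').symm]

lemma selmer_dyn (m : ℕ) : ∃ (β K ε : ℝ) (x0 : Fin (m + 3) → ℝ), 1 ≤ β ∧ 1 < K ∧ 0 < ε ∧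
    x0 0 = 1 ∧ (∀ x : Fin (m + 3) → ℝ, (∀ i, |x i - x0 i| ≤ ε) → x ∈ selmerG m) ∧
    ∀ (x : Fin (m + 3) → ℝ) (q : ℕ) (N : Matrix (Fin (m + 3)) (Fin (m + 3)) ℝ) (s : ℝ),
      0 < s → (∀ i, |x i - x0 i| ≤ ε) → (∀ j, 0 < colSum m N j) →
      q * (∑ k : Fin (m + 2), colSum m N k.succ) ≤ 2 * ∑ k, colSum m N k →
      ∃ n : ℕ, IsBalanced m β (N * selmerMat m (selmerShift m q (s • x)) n) ∧
          colMax m (N * selmerMat m (selmerShift m q (s • x)) n) ≤ K * colMax m N := by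
  set k := (m + 3) * (m + 3) with hk
  set P := selmerB2 m ^ k with hP
  have hPpos : ∀ i j, 0 < P i j := selmerB2_pow_pos
  obtain ⟨a, ha, hPa⟩ : ∃ a : ℝ, 0 < a ∧ ∀ i j, a ≤ P i j := by
    obtain ⟨p, hp⟩ := Finite.exists_min (fun p : Fin (m + 3) × Fin (m + 3) => P p.1 p.2)
    exact ⟨P p.1 p.2, hPpos _ _, fun i j => hp (i, j)⟩
  obtain ⟨b, hb1, hPb⟩ : ∃ b : ℝ, 1 ≤ b ∧ ∀ i j, P i j ≤ b := by
    obtain ⟨p, hp⟩ := Finite.exists_max (fun p : Fin (m + 3) × Fin (m + 3) => P p.1 p.2)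
    exact ⟨max 1 (P p.1 p.2), le_max_left _ _, fun i j => (hp (i, j)).trans (le_max_right _ _)⟩
  have hab : a ≤ b := (hPa 0 0).trans (hPb 0 0)
  obtain ⟨w, hw⟩ := selmerW_nonempty (m := m) k
  have hw0 : 0 < w 0 := (selmerW_sub_G k hw).1
  set x0 := (w 0)⁻¹ • w with hx0
  have hx0W : x0 ∈ selmerW m k := selmerW_smul k _ (inv_pos.mpr hw0) w hw
  obtain ⟨ε, hε, hball⟩ := Metric.isOpen_iff.mp (selmerW_open (m := m) k) x0 hx0W
  have hclose : ∀ x : Fin (m + 3) → ℝ, (∀ i, |x i - x0 i| ≤ ε / 2) → x ∈ selmerW m k := by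
    intro x hx
    apply hball
    rw [Metric.mem_ball]
    refine lt_of_le_of_lt ((dist_pi_le_iff (by positivity)).mpr fun i => ?_) (half_lt_self hε)
    rw [Real.dist_eq]; exact hx i
  refine ⟨b / a, 3 * b * (m + 3) + 1, ε / 2, x0, ?_, ?_, by positivity, ?_, ?_, ?_⟩
  · rw [le_div_iff₀ ha]; linarith
  · have : 0 < 3 * b * ((m : ℝ) + 3) := by positivity
    linarith
  · simp [hx0, hw0.ne']
  · intro x hx; exact selmerW_sub_G k (hclose x hx)
  · intro x q N s hs hx hN hq
    have hxW : s • x ∈ selmerW m k := selmerW_smul k s hs x (hclose x hx)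
    obtain ⟨g1, g2, g3⟩ := selmerW_sub_G k hxW
    have hmono : StrictMono (s • x) := Fin.strictMono_iff_lt_succ.mpr g2
    have hmat : selmerMat m (selmerShift m q (s • x)) ((m + 2) * q + k) =
        selmerB1 m ^ ((m + 2) * q) * P := by
      obtain ⟨b1, b2, -, -⟩ := selmerB1_pow_branch (s • x) g1.le
        (fun i => hmono.monotone (Fin.zero_le i)) ((m + 2) * q)
      rw [← selmerB1_pow_shift, selmerMat_add, b1, b2, selmerW_mat k _ hxW]
    refine ⟨(m + 2) * q + k, ?_⟩
    rw [hmat, ← Matrix.mul_assoc]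
    set N' := N * selmerB1 m ^ ((m + 2) * q) with hN'
    have hA : 0 ≤ ∑ k : Fin (m + 2), colSum m N k.succ :=
      Finset.sum_nonneg fun k _ => (hN _).le
    have hN'0 : ∀ j, 0 ≤ colSum m N' j := by
      intro j
      rw [hN', colSum_B1_pow]
      split_ifs
      · have := (hN j).le; positivity
      · simpa using (hN j).le
    set T := ∑ k, colSum m N k with hT
    set T' := ∑ k, colSum m N' k with hT'
    have hT'T : T' ≤ 3 * T := by
      have : T' = T + q * (∑ k : Fin (m + 2), colSum m N k.succ) := by
        simp only [hT', hN', colSum_B1_pow, Finset.sum_add_distrib, ← hT]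
        simp
      linarith
    have hTmax : T ≤ (m + 3) * colMax m N := by
      have := Finset.sum_le_card_nsmul Finset.univ (fun k => colSum m N k) (colMax m N)
        (fun k _ => colSum_le_colMax N k)
      simpa using this
    have hT'0 : 0 ≤ T' := Finset.sum_nonneg fun k _ => hN'0 k
    have up : ∀ j, colSum m (N' * P) j ≤ b * T' := by
      intro j
      rw [colSum_mul, hT', Finset.mul_sum]
      refine Finset.sum_le_sum fun i _ => ?_
      rw [mul_comm]
      exact mul_le_mul_of_nonneg_right (hPb i j) (hN'0 i)
    have lo : ∀ j, a * T' ≤ colSum m (N' * P) j := by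
      intro j
      rw [colSum_mul, hT', Finset.mul_sum]
      refine Finset.sum_le_sum fun i _ => ?_
      rw [mul_comm (colSum m N' i)]
      exact mul_le_mul_of_nonneg_right (hPa i j) (hN'0 i)
    have hup := colMax_le _ _ up
    constructor
    · intro j
      refine hup.trans ?_
      have := mul_le_mul_of_nonneg_left (lo j) (show 0 ≤ b / a by positivity)
      refine le_trans (le_of_eq ?_) this
      field_simp
    · refine hup.trans ?_
      have h0 : 0 < colMax m N := (hN 0).trans_le (colSum_le_colMax N 0)
      have : b * T' ≤ b * (3 * ((m + 3) * colMax m N)) := by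
        apply mul_le_mul_of_nonneg_left _ (by linarith)
        linarith
      linarith

end SelmerDynamics

section SelmerMeasure

open scoped ENNReal NNReal

variable {m : ℕ}

lemma selmer_omega_facts (v : EuclideanSpace ℝ (Fin (m + 3))) (hv : v ∈ selmerSimplexE m) :
    (∀ i, 0 ≤ v i) ∧ (∀ i, v i ≤ 1) ∧ 1 ≤ 2 * ((m : ℝ) + 3) * v 1 := by
  obtain ⟨h0, h1, h2, h3⟩ := hv
  have hn : ∀ i, 0 ≤ v i := fun i => h0.trans (h1 0 i (Fin.zero_le i))
  refine ⟨hn, fun i => ?_, ?_⟩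
  · rw [← h3]; exact Finset.single_le_sum (fun i _ => hn i) (Finset.mem_univ i)
  · have h01 := h1 0 1 (Fin.zero_le _)
    have : ∑ i, v i ≤ ∑ i : Fin (m + 3), 2 * v 1 := by
      refine Finset.sum_le_sum fun i _ => ?_
      linarith [h1 i (Fin.last (m + 2)) (Fin.le_last i)]
    rw [h3] at this
    simp at this
    linarith

lemma selmerSimplexE_closed : IsClosed (selmerSimplexE m) := by
  have : selmerSimplexE m = {x | 0 ≤ x 0} ∩ ((⋂ i, ⋂ j, ⋂ _ : i ≤ j, {x | x i ≤ x j}) ∩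
    ({x | x (Fin.last (m + 2)) ≤ x 0 + x 1} ∩ {x | ∑ i, x i = 1})) := by
    ext x; simp [selmerSimplexE]
  rw [this]
  refine IsClosed.inter (isClosed_le (by fun_prop) (by fun_prop)) (IsClosed.inter ?_
    (IsClosed.inter (isClosed_le (by fun_prop) (by fun_prop))
      (isClosed_eq (by fun_prop) (by fun_prop))))
  exact isClosed_iInter fun i => isClosed_iInter fun j => isClosed_iInter fun _ =>
    isClosed_le (by fun_prop) (by fun_prop)

lemma selmer_muH_eq : (μH[(m + 2 : ℝ)] : Measure (Fin (m + 2) → ℝ)) = volume := by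
  rw [← MeasureTheory.hausdorffMeasure_pi_real]
  simp

/-- linear parametrisation of the hyperplane -/
noncomputable def selmerPsi (m : ℕ) (u : Fin (m + 2) → ℝ) : EuclideanSpace ℝ (Fin (m + 3)) :=
  WithLp.toLp 2 (Fin.cases (u 0)
    (fun i => (1 - ∑ k, u k) / ((m : ℝ) + 2) + if i = 0 then 0 else u i))

lemma selmerPsi_lip : ∃ L : ℝ≥0, LipschitzWith L (selmerPsi m) := by
  have h1 : LipschitzWith 2 (fun u : Fin (m + 2) → ℝ =>
      (Fin.cases (u 0) (fun i => (1 - ∑ k, u k) / ((m : ℝ) + 2) + if i = 0 then 0 else u i) :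
        Fin (m + 3) → ℝ)) := by
    apply LipschitzWith.of_dist_le_mul
    intro u u'
    refine (dist_pi_le_iff (by positivity)).mpr fun i => ?_
    have hd : ∀ k, |u k - u' k| ≤ dist u u' := fun k => by
      rw [← Real.dist_eq]; exact dist_le_pi_dist u u' k
    have hd0 : 0 ≤ dist u u' := dist_nonneg
    have hc : |(1 - ∑ k, u k) / ((m : ℝ) + 2) - (1 - ∑ k, u' k) / ((m : ℝ) + 2)| ≤ dist u u' := by
      rw [← sub_div, abs_div, abs_of_pos (show (0 : ℝ) < (m : ℝ) + 2 by positivity),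
        div_le_iff₀ (by positivity)]
      have : 1 - ∑ k, u k - (1 - ∑ k, u' k) = - ∑ k, (u k - u' k) := by
        rw [Finset.sum_sub_distrib]; ring
      rw [this, abs_neg]
      refine (Finset.abs_sum_le_sum_abs _ _).trans ?_
      have := Finset.sum_le_card_nsmul Finset.univ (fun k => |u k - u' k|) (dist u u')
        (fun k _ => hd k)
      simp at this
      linarith
    rw [Real.dist_eq]
    refine Fin.cases ?_ (fun i => ?_) i
    · simp only [Fin.cases_zero]
      have := hd 0
      simp only [NNReal.coe_ofNat]; linarith
    · simp only [Fin.cases_succ, NNReal.coe_ofNat]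
      split_ifs
      · simp only [add_zero]; linarith
      · have := hd i
        rw [abs_le] at *
        constructor <;> linarith [this.1, this.2, hc.1, hc.2]
  exact ⟨_, (PiLp.lipschitzWith_toLp 2 (fun _ : Fin (m + 3) => ℝ)).comp h1⟩

lemma selmerPsi_surj (v : EuclideanSpace ℝ (Fin (m + 3))) (hv : v ∈ selmerSimplexE m) :
    selmerPsi m (fun i => if i = 0 then v 0 else v i.succ - v 1) = v := by
  obtain ⟨h0, h1, h2, h3⟩ := hv
  have hs : ∑ k : Fin (m + 2), (if k = 0 then v 0 else v k.succ - v 1) = 1 - (m + 2) * v 1 := by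
    rw [← h3, Fin.sum_univ_succ, Fin.sum_univ_succ (n := m + 2), Fin.sum_univ_succ (n := m + 1)]
    simp [Finset.sum_sub_distrib]
    ring
  ext i
  simp only [selmerPsi]
  rw [hs]
  refine Fin.cases ?_ (fun i => ?_) i
  · simp
  · simp only [Fin.cases_succ]
    have : (1 - (1 - ((m : ℝ) + 2) * v 1)) / ((m : ℝ) + 2) = v 1 := by
      field_simp; ring
    rw [this]
    split_ifs with hi
    · subst hi; simp
    · ring

lemma selmer_slab : ∃ L : ℝ, 0 < L ∧ ∀ Q k : ℕ, 1 ≤ Q →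
    μH[(m + 2 : ℝ)] {v ∈ selmerSimplexE m | (k : ℝ) / Q ≤ v 0 ∧ v 0 ≤ ((k : ℝ) + 1) / Q} ≤
      ENNReal.ofReal (L * ((Q : ℝ) ^ (m + 2))⁻¹ * ((k : ℝ) + 1) ^ (m + 1)) := by
  obtain ⟨L, hL⟩ := selmerPsi_lip (m := m)
  refine ⟨(L : ℝ) ^ (m + 2) + 1, by positivity, fun Q k hQ => ?_⟩
  have hQ0 : (0 : ℝ) < Q := by exact_mod_cast hQ
  set box : Set (Fin (m + 2) → ℝ) := Set.Icc (fun i => if i = 0 then (k : ℝ) / Q else 0)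
    (fun _ => ((k : ℝ) + 1) / Q) with hbox
  have hsub : {v ∈ selmerSimplexE m | (k : ℝ) / Q ≤ v 0 ∧ v 0 ≤ ((k : ℝ) + 1) / Q} ⊆
      selmerPsi m '' box := by
    rintro v ⟨hv, hk1, hk2⟩
    refine ⟨_, ?_, selmerPsi_surj v hv⟩
    obtain ⟨h0, h1, h2, h3⟩ := hv
    constructor
    · intro i
      by_cases hi : i = 0
      · simp [hi, hk1]
      · simp only [if_neg hi]
        linarith [h1 1 i.succ (by rw [Fin.le_def]; simp)]
    · intro i
      by_cases hi : i = 0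
      · simp [hi, hk2]
      · simp only [if_neg hi]
        linarith [h1 i.succ (Fin.last (m + 2)) (Fin.le_last _)]
  have hvol : volume box = ENNReal.ofReal (((Q : ℝ) ^ (m + 2))⁻¹ * ((k : ℝ) + 1) ^ (m + 1)) := by
    rw [hbox, Real.volume_Icc_pi, Fin.prod_univ_succ]
    simp only [Fin.succ_ne_zero, if_true, if_false, sub_zero]
    rw [Finset.prod_const, Finset.card_univ, Fintype.card_fin,
      ← ENNReal.ofReal_pow (by positivity), ← ENNReal.ofReal_mul' (by positivity)]
    congr 1
    rw [div_pow, ← sub_div]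
    field_simp
    ring
  refine (measure_mono hsub).trans ?_
  refine (hL.hausdorffMeasure_image_le (by positivity) box).trans ?_
  rw [selmer_muH_eq, hvol, mul_assoc,
    ENNReal.ofReal_mul (p := (L : ℝ) ^ (m + 2) + 1) (by positivity)]
  refine mul_le_mul' ?_ le_rfl
  have : (L : ℝ≥0∞) ^ ((m : ℝ) + 2) = ENNReal.ofReal ((L : ℝ) ^ (m + 2)) := by
    rw [ENNReal.ofReal_pow (by positivity), ENNReal.ofReal_coe_nnreal, ← ENNReal.rpow_natCast]
    push_cast; rfl
  rw [this]
  exact ENNReal.ofReal_le_ofReal (by linarith)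

lemma selmer_den (m : ℕ) : ∃ c : ℝ, 0 < c ∧ ∀ (C : Fin (m + 3) → ℝ) (A : ℝ) (Q : ℕ),
    (∀ j, 0 < C j) → A = ∑ k : Fin (m + 2), C k.succ → 1 ≤ Q → Q * A ≤ C 0 + A →
    ∫⁻ v in selmerSimplexE m, ENNReal.ofReal (((∑ j, C j * v j) ^ (m + 3))⁻¹) ∂(μH[(m + 2 : ℝ)]) ≤
      ENNReal.ofReal (c * ((A ^ (m + 3))⁻¹ * ((Q : ℝ) ^ (m + 2))⁻¹)) := by
  obtain ⟨L, hL, hslab⟩ := selmer_slab (m := m)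
  have hsum : Summable (fun k : ℕ => (((k : ℝ) + 1) ^ 2)⁻¹) := by
    have := (summable_nat_add_iff 1).mpr (Real.summable_nat_pow_inv.mpr (one_lt_two))
    simpa using this
  set Z := ∑' k : ℕ, (((k : ℝ) + 1) ^ 2)⁻¹ with hZ
  have hZ0 : 0 ≤ Z := tsum_nonneg fun k => by positivity
  set H : ℝ := (4 * ((m : ℝ) + 3)) ^ (m + 3) with hH
  refine ⟨H * L * Z + 1, by positivity, fun C A Q hC hA hQ hQA => ?_⟩
  have hQ0 : (0 : ℝ) < Q := by exact_mod_cast hQ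
  have hA0 : 0 < A := by
    rw [hA]; exact Finset.sum_pos (fun k _ => hC _) Finset.univ_nonempty
  set slab : ℕ → Set (EuclideanSpace ℝ (Fin (m + 3))) := fun k =>
    {v ∈ selmerSimplexE m | (k : ℝ) / Q ≤ v 0 ∧ v 0 ≤ ((k : ℝ) + 1) / Q} with hsl
  have hcover : selmerSimplexE m ⊆ ⋃ k, slab k := by
    intro v hv
    have h0 : 0 ≤ v 0 * Q := mul_nonneg hv.1 hQ0.le
    refine Set.mem_iUnion.mpr ⟨⌊v 0 * Q⌋₊, hv, ?_, ?_⟩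
    · rw [div_le_iff₀ hQ0]; exact Nat.floor_le h0
    · rw [le_div_iff₀ hQ0]; exact (Nat.lt_floor_add_one _).le
  have hmeas : ∀ k, MeasurableSet (slab k) := by
    intro k
    have : slab k = selmerSimplexE m ∩ ({v | (k : ℝ) / Q ≤ v 0} ∩ {v | v 0 ≤ ((k : ℝ) + 1) / Q}) := by
      ext v; simp [hsl]; tauto
    rw [this]
    exact (selmerSimplexE_closed.inter ((isClosed_le (by fun_prop) (by fun_prop)).inter
      (isClosed_le (by fun_prop) (by fun_prop)))).measurableSet
  have hbound : ∀ k, ∀ v ∈ slab k, ((∑ j, C j * v j) ^ (m + 3))⁻¹ ≤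
      H * (A ^ (m + 3))⁻¹ * (((k : ℝ) + 1) ^ (m + 3))⁻¹ := by
    rintro k v ⟨hv, hk1, hk2⟩
    obtain ⟨f1, f2, f3⟩ := selmer_omega_facts v hv
    obtain ⟨h0, h1, h2, h3⟩ := hv
    have e : C 0 * v 0 + A * v 1 ≤ ∑ j, C j * v j := by
      rw [Fin.sum_univ_succ, hA, Finset.sum_mul]
      gcongr with i _
      · exact (hC _).le
      · exact h1 _ _ (by rw [Fin.le_def]; simp)
    rw [div_le_iff₀ hQ0] at hk1
    have g : A * ((k : ℝ) + 1) ≤ 4 * ((m : ℝ) + 3) * ∑ j, C j * v j := by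
      have a1 : A * k ≤ A * (v 0 * Q) := by gcongr
      have a2 : (Q * A) * v 0 ≤ (C 0 + A) * v 0 := mul_le_mul_of_nonneg_right hQA h0
      have a3 : A * v 0 ≤ A * 1 := by gcongr; exact f2 0
      have a4 : A * 1 ≤ A * (2 * ((m : ℝ) + 3) * v 1) := by gcongr
      have a5 : 0 ≤ C 0 * v 0 := mul_nonneg (hC 0).le h0
      have a6 : 4 * ((m : ℝ) + 3) * (C 0 * v 0 + A * v 1) ≤ 4 * ((m : ℝ) + 3) * ∑ j, C j * v j := by
        gcongr
      have a7 : 0 ≤ (m : ℝ) * (C 0 * v 0) := by positivity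
      nlinarith
    have gpos : 0 < A * ((k : ℝ) + 1) := by positivity
    have gp := pow_le_pow_left₀ gpos.le g (m + 3)
    rw [mul_pow, mul_pow, ← hH] at gp
    have spos : 0 < ∑ j, C j * v j := by
      by_contra hcon
      have : 4 * ((m : ℝ) + 3) * ∑ j, C j * v j ≤ 0 :=
        mul_nonpos_of_nonneg_of_nonpos (by positivity) (not_lt.mp hcon)
      linarith
    have spp : 0 < (∑ j, C j * v j) ^ (m + 3) := by positivity
    rw [mul_assoc, ← mul_inv, ← div_eq_mul_inv, le_div_iff₀ (by positivity), inv_mul_le_iff₀ spp,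
      mul_comm _ H]
    exact gp
  have step : ∀ k, ∫⁻ v in slab k, ENNReal.ofReal (((∑ j, C j * v j) ^ (m + 3))⁻¹)
      ∂(μH[(m + 2 : ℝ)]) ≤
      ENNReal.ofReal (H * L * ((A ^ (m + 3))⁻¹ * ((Q : ℝ) ^ (m + 2))⁻¹) * (((k : ℝ) + 1) ^ 2)⁻¹) := by
    intro k
    calc _ ≤ ∫⁻ v in slab k, ENNReal.ofReal (H * (A ^ (m + 3))⁻¹ * (((k : ℝ) + 1) ^ (m + 3))⁻¹)
          ∂(μH[(m + 2 : ℝ)]) :=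
        setLIntegral_mono' (hmeas k) fun v hv => ENNReal.ofReal_le_ofReal (hbound k v hv)
      _ = ENNReal.ofReal (H * (A ^ (m + 3))⁻¹ * (((k : ℝ) + 1) ^ (m + 3))⁻¹) *
          μH[(m + 2 : ℝ)] (slab k) := setLIntegral_const _ _
      _ ≤ ENNReal.ofReal (H * (A ^ (m + 3))⁻¹ * (((k : ℝ) + 1) ^ (m + 3))⁻¹) *
          ENNReal.ofReal (L * ((Q : ℝ) ^ (m + 2))⁻¹ * ((k : ℝ) + 1) ^ (m + 1)) := by
        gcongr; exact hslab Q k hQ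
      _ = _ := by
        rw [← ENNReal.ofReal_mul (by positivity)]
        congr 1
        have : ((k : ℝ) + 1) ≠ 0 := by positivity
        field_simp
        ring
  calc _ ≤ ∫⁻ v in ⋃ k, slab k, ENNReal.ofReal (((∑ j, C j * v j) ^ (m + 3))⁻¹)
          ∂(μH[(m + 2 : ℝ)]) := lintegral_mono_set hcover
    _ ≤ ∑' k, ∫⁻ v in slab k, ENNReal.ofReal (((∑ j, C j * v j) ^ (m + 3))⁻¹)
          ∂(μH[(m + 2 : ℝ)]) := lintegral_iUnion_le _ _
    _ ≤ ∑' k : ℕ, ENNReal.ofReal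
        (H * L * ((A ^ (m + 3))⁻¹ * ((Q : ℝ) ^ (m + 2))⁻¹) * (((k : ℝ) + 1) ^ 2)⁻¹) :=
        ENNReal.tsum_le_tsum step
    _ = ENNReal.ofReal (H * L * ((A ^ (m + 3))⁻¹ * ((Q : ℝ) ^ (m + 2))⁻¹) * Z) := by
        rw [← ENNReal.ofReal_tsum_of_nonneg (fun k => by positivity) (hsum.mul_left _),
          tsum_mul_left]
    _ ≤ _ := by
        apply ENNReal.ofReal_le_ofReal
        have : 0 ≤ (A ^ (m + 3))⁻¹ * ((Q : ℝ) ^ (m + 2))⁻¹ := by positivity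
        nlinarith

/-- projective chart -/
noncomputable def selmerChi (m : ℕ) (v : EuclideanSpace ℝ (Fin (m + 3))) : Fin (m + 2) → ℝ := fun i =>
  if i = 0 then v 0 / v 1 else v i.succ / v 1 - 1

lemma selmerChi_lip : ∃ L : ℝ≥0, LipschitzOnWith L (selmerChi m) (selmerSimplexE m) := by
  set D : ℝ := 2 * ((m : ℝ) + 3) with hD
  have hD0 : 0 < D := by positivity
  refine ⟨Real.toNNReal (2 * D ^ 2), LipschitzOnWith.of_dist_le_mul fun v hv v' hv' => ?_⟩
  obtain ⟨f1, f2, f3⟩ := selmer_omega_facts v hv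
  obtain ⟨f1', f2', f3'⟩ := selmer_omega_facts v' hv'
  rw [← hD] at f3 f3'
  have p1 : 0 < v 1 := by by_contra h; nlinarith
  have p1' : 0 < v' 1 := by by_contra h; nlinarith
  have hd : ∀ k, |v k - v' k| ≤ dist v v' := fun k => by
    rw [← Real.dist_eq]
    have := (PiLp.lipschitzWith_ofLp 2 (fun _ : Fin (m + 3) => ℝ)).dist_le_mul v v'
    have h2 := dist_le_pi_dist v.ofLp v'.ofLp k
    simp at this
    exact h2.trans this
  have key : ∀ k, |v k / v 1 - v' k / v' 1| ≤ 2 * D ^ 2 * dist v v' := by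
    intro k
    have e : v k / v 1 - v' k / v' 1 =
        ((v k - v' k) * v' 1 + v' k * (v' 1 - v 1)) / (v 1 * v' 1) := by
      field_simp; ring
    have h1 : |(v k - v' k) * v' 1 + v' k * (v' 1 - v 1)| ≤ 2 * dist v v' := by
      refine (abs_add_le _ _).trans ?_
      rw [abs_mul, abs_mul, abs_of_nonneg (f1' 1), abs_of_nonneg (f1' k), abs_sub_comm (v' 1)]
      have a1 : |v k - v' k| * v' 1 ≤ dist v v' * 1 := by
        gcongr
        · exact hd k
        · exact f2' 1
      have a2 : v' k * |v 1 - v' 1| ≤ 1 * dist v v' := by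
        gcongr
        · exact f2' k
        · exact hd 1
      linarith
    have h2 : 1 ≤ D ^ 2 * (v 1 * v' 1) := by
      have := mul_le_mul f3 f3' zero_le_one (by positivity)
      nlinarith
    rw [e, abs_div, abs_of_pos (mul_pos p1 p1'), div_le_iff₀ (mul_pos p1 p1')]
    have hdd : 0 ≤ dist v v' := dist_nonneg
    nlinarith [mul_le_mul_of_nonneg_left h2 hdd]
  refine (dist_pi_le_iff (by positivity)).mpr fun i => ?_
  rw [Real.dist_eq, Real.coe_toNNReal _ (by positivity)]
  simp only [selmerChi]
  split_ifs
  · exact key 0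
  · rw [sub_sub_sub_cancel_right]; exact key i.succ

/-- The good set. -/
def selmerGood (m : ℕ) (x0 : Fin (m + 3) → ℝ) (ε : ℝ) (Q : ℕ) :
    Set (EuclideanSpace ℝ (Fin (m + 3))) :=
  {v | v ∈ selmerSimplexE m ∧ 0 < v 0 ∧ ∃ q : ℕ, (Q ≤ q ∧ q < 2 * Q) ∧
    ∀ i : Fin (m + 2), |v i.succ / v 0 - q - x0 i.succ| ≤ ε}

lemma selmerGood_meas (x0 : Fin (m + 3) → ℝ) (ε : ℝ) (Q : ℕ) :
    MeasurableSet (selmerGood m x0 ε Q) := by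
  have : selmerGood m x0 ε Q = selmerSimplexE m ∩ ({v | 0 < v 0} ∩ ⋃ q : ℕ,
      ⋃ _ : (Q ≤ q ∧ q < 2 * Q), ⋂ i : Fin (m + 2),
        {v | |v i.succ / v 0 - q - x0 i.succ| ≤ ε}) := by
    ext v; simp [selmerGood]; tauto
  rw [this]
  refine selmerSimplexE_closed.measurableSet.inter
    ((measurableSet_lt measurable_const (by fun_prop)).inter ?_)
  refine MeasurableSet.iUnion fun q => MeasurableSet.iUnion fun _ => MeasurableSet.iInter fun i => ?_
  refine measurableSet_le ?_ measurable_const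
  have : Measurable fun v : EuclideanSpace ℝ (Fin (m + 3)) =>
      v i.succ / v 0 - q - x0 i.succ := by fun_prop
  exact continuous_abs.measurable.comp this

end SelmerMeasure

section SelmerFinal

open scoped ENNReal NNReal

/-- vector in the cone with second coordinate one -/
noncomputable def selmerP (m : ℕ) (u : Fin (m + 2) → ℝ) : Fin (m + 3) → ℝ :=
  Fin.cases (u 0) (fun i => if i = 0 then 1 else 1 + u i)

/-- box lower corner -/
noncomputable def selmerLo (m : ℕ) (x0 : Fin (m + 3) → ℝ) (δ : ℝ) (q : ℕ) : Fin (m + 2) → ℝ :=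
  fun i => if i = 0 then 1 / (q + x0 1 + δ) else (x0 i.succ - x0 1) / (q + x0 1)

/-- box upper corner -/
noncomputable def selmerHi (m : ℕ) (x0 : Fin (m + 3) → ℝ) (δ : ℝ) (q : ℕ) : Fin (m + 2) → ℝ :=
  fun i => if i = 0 then 1 / (q + x0 1) else (x0 i.succ - x0 1 + 2 * δ) / (q + x0 1 + δ)

lemma selmer_box_sub {m : ℕ} (x0 : Fin (m + 3) → ℝ) (ε δ : ℝ) (hδ : 0 < δ) (hδε : 3 * δ ≤ ε)
    (h1 : x0 0 = 1) (hG : ∀ x : Fin (m + 3) → ℝ, (∀ i, |x i - x0 i| ≤ ε) → x ∈ selmerG m)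
    (Q q : ℕ) (hq : Q ≤ q ∧ q < 2 * Q) (u : Fin (m + 2) → ℝ)
    (hu : u ∈ Set.Icc (selmerLo m x0 δ q) (selmerHi m x0 δ q)) :
    u ∈ selmerChi m '' selmerGood m x0 ε Q := by
  have hx0 : x0 ∈ selmerG m := hG x0 (fun i => by simp; linarith)
  obtain ⟨g1, g2, g3⟩ := hx0
  have hmono : StrictMono x0 := Fin.strictMono_iff_lt_succ.mpr g2
  have h01 : x0 0 < x0 1 := hmono (by rw [Fin.lt_def]; simp)
  set a : ℝ := q + x0 1 with ha
  have ha0 : 0 < a := by have : (0 : ℝ) ≤ q := by positivity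
                         linarith
  have l0 := hu.1 0
  have u0 := hu.2 0
  simp only [selmerLo, selmerHi, if_true, ← ha] at l0 u0
  have hs : 0 < u 0 := lt_of_lt_of_le (by positivity) l0
  have s1 : a ≤ 1 / u 0 := by rw [le_div_iff₀ hs]; rw [le_div_iff₀ ha0] at u0; linarith
  have s2 : 1 / u 0 ≤ a + δ := by
    rw [div_le_iff₀ hs]; rw [div_le_iff₀ (by positivity)] at l0; linarith
  have e1 : ∀ i : Fin (m + 2), i ≠ 0 → x0 i.succ - x0 1 ≤ u i / u 0 ∧
      u i / u 0 ≤ x0 i.succ - x0 1 + 2 * δ := by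
    intro i hi
    have l := hu.1 i
    have r := hu.2 i
    simp only [selmerLo, selmerHi, if_neg hi, ← ha] at l r
    have hn : 0 ≤ x0 i.succ - x0 1 := by
      have : x0 1 ≤ x0 i.succ := hmono.monotone (by rw [Fin.le_def]; simp)
      linarith
    rw [div_le_iff₀ ha0] at l
    rw [le_div_iff₀ (by positivity)] at r
    rw [div_eq_mul_one_div (u i)]
    have hui : 0 ≤ u i := by by_contra h; nlinarith
    constructor
    · exact l.trans (mul_le_mul_of_nonneg_left s1 hui)
    · exact (mul_le_mul_of_nonneg_left s2 hui).trans r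
  -- the point `x`
  set x : Fin (m + 3) → ℝ := fun i => if i = 0 then 1 else selmerP m u i / u 0 - q with hx
  have hclose : ∀ i, |x i - x0 i| ≤ ε := by
    intro i
    refine Fin.cases ?_ (fun i => ?_) i
    · simp [hx, h1]; linarith
    · simp only [hx, Fin.succ_ne_zero, if_false, selmerP, Fin.cases_succ]
      by_cases hi : i = 0
      · subst hi
        simp only [if_true, Fin.succ_zero_eq_one]
        rw [abs_le]; constructor <;> linarith
      · simp only [if_neg hi]
        obtain ⟨p1, p2⟩ := e1 i hi
        rw [add_div, abs_le]; constructor <;> linarith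
  obtain ⟨k1, k2, k3⟩ := hG x hclose
  have kmono : StrictMono x := Fin.strictMono_iff_lt_succ.mpr k2
  have hx1 : x 0 = 1 := by simp [hx]
  have hxs : ∀ i, i ≠ 0 → selmerP m u i = (x i + q) * u 0 := by
    intro i hi
    simp only [hx, if_neg hi]
    field_simp; ring
  have hP0 : selmerP m u 0 = u 0 := by simp [selmerP]
  have hP1 : selmerP m u 1 = 1 := by
    rw [← Fin.succ_zero_eq_one]; simp only [selmerP, Fin.cases_succ, if_true]
  have hq0 : (0 : ℝ) ≤ q := by positivity
  have hPpos : ∀ i, 0 < selmerP m u i := by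
    intro i
    by_cases hi : i = 0
    · rw [hi, hP0]; exact hs
    · rw [hxs i hi]
      have : x 0 < x i := kmono (Fin.pos_iff_ne_zero.mpr hi)
      have : 0 < x i + q := by linarith
      positivity
  have hPmono : ∀ i j, i ≤ j → selmerP m u i ≤ selmerP m u j := by
    intro i j hij
    by_cases hj : j = 0
    · have : i = 0 := by subst hj; exact Fin.le_zero_iff.mp hij
      rw [this, hj]
    · rw [hxs j hj]
      by_cases hi : i = 0
      · rw [hi, hP0]
        have : x 0 < x j := kmono (Fin.pos_iff_ne_zero.mpr hj)
        nlinarith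
      · rw [hxs i hi]
        have : x i ≤ x j := kmono.monotone hij
        gcongr
  have hPlast : selmerP m u (Fin.last (m + 2)) ≤ selmerP m u 0 + selmerP m u 1 := by
    rw [hxs (Fin.last (m + 2)) (Fin.last_pos.ne'), hxs 1 (by simp), hP0]
    have := mul_le_mul_of_nonneg_right k3.le hs.le
    rw [hx1] at this
    linarith
  set σ := ∑ i, selmerP m u i with hσ
  have hσ0 : 0 < σ := Finset.sum_pos (fun i _ => hPpos i) Finset.univ_nonempty
  refine ⟨WithLp.toLp 2 (fun i => selmerP m u i / σ), ⟨⟨?_, ?_, ?_, ?_⟩, ?_, q, hq, ?_⟩, ?_⟩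
  · exact (div_pos (hPpos 0) hσ0).le
  · intro i j hij
    exact div_le_div_of_nonneg_right (hPmono i j hij) hσ0.le
  · simp only [← add_div]
    exact div_le_div_of_nonneg_right hPlast hσ0.le
  · simp only [← Finset.sum_div, ← hσ]
    exact div_self hσ0.ne'
  · exact div_pos (hPpos 0) hσ0
  · intro i
    simp only [div_div_div_cancel_right₀ hσ0.ne']
    have := hclose i.succ
    simpa only [hx, Fin.succ_ne_zero, if_false, hP0] using this
  · funext i
    simp only [selmerChi, div_div_div_cancel_right₀ hσ0.ne', hP0, hP1]
    split_ifs with hi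
    · rw [hi]; simp
    · simp [selmerP, hi]

lemma selmer_num (m : ℕ) (x0 : Fin (m + 3) → ℝ) (ε : ℝ) (hε : 0 < ε)
    (h1 : x0 0 = 1) (hG : ∀ x : Fin (m + 3) → ℝ, (∀ i, |x i - x0 i| ≤ ε) → x ∈ selmerG m) :
    ∃ c : ℝ, 0 < c ∧ ∀ Q : ℕ, 1 ≤ Q →
      ENNReal.ofReal (c * ((Q : ℝ) ^ (m + 2))⁻¹) ≤ μH[(m + 2 : ℝ)] (selmerGood m x0 ε Q) := by
  obtain ⟨L, hL⟩ := selmerChi_lip (m := m)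
  obtain ⟨δ, hδ, hδε, hδ1⟩ : ∃ δ : ℝ, 0 < δ ∧ 3 * δ ≤ ε ∧ δ < 1 := by
    refine ⟨min (ε / 3) (1 / 2), by positivity, ?_, ?_⟩
    · have := min_le_left (ε / 3) (1 / 2); linarith
    · have := min_le_right (ε / 3) (1 / 2); linarith
  have hx0 : x0 ∈ selmerG m := hG x0 (fun i => by simp; linarith)
  obtain ⟨g1, g2, g3⟩ := hx0
  have hmono : StrictMono x0 := Fin.strictMono_iff_lt_succ.mpr g2
  have h01 : x0 0 < x0 1 := hmono (by rw [Fin.lt_def]; simp)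
  set κ : ℝ := x0 1 + 3 with hκ
  have hκ0 : 0 < κ := by linarith
  set M : ℝ := (L : ℝ) ^ (m + 2) + 1 with hM
  have hM0 : 0 < M := by positivity
  set c0 : ℝ := δ ^ (m + 2) / κ ^ (m + 3) with hc0
  have hc00 : 0 < c0 := by positivity
  refine ⟨c0 / M, by positivity, fun Q hQ => ?_⟩
  have hQ0 : (0 : ℝ) < Q := by exact_mod_cast hQ
  have hQ1 : (1 : ℝ) ≤ Q := by exact_mod_cast hQ
  set box : ℕ → Set (Fin (m + 2) → ℝ) := fun q =>
    Set.Icc (selmerLo m x0 δ q) (selmerHi m x0 δ q) with hbox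
  have hvol : ∀ q ∈ Finset.Ico Q (2 * Q),
      ENNReal.ofReal (c0 * ((Q : ℝ) ^ (m + 3))⁻¹) ≤ volume (box q) := by
    intro q hq
    rw [Finset.mem_Ico] at hq
    have hq1 : (1 : ℝ) ≤ q := by exact_mod_cast hQ.trans hq.1
    have hq2 : (q : ℝ) ≤ 2 * Q := by exact_mod_cast hq.2.le
    have haκ : q + x0 1 + δ ≤ Q * κ := by
      rw [hκ]; nlinarith
    have ha0 : 0 < q + x0 1 := by linarith
    have had : 0 < q + x0 1 + δ := by linarith
    rw [hbox, Real.volume_Icc_pi, Fin.prod_univ_succ]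
    have f0 : δ / (Q * κ) ^ 2 ≤ selmerHi m x0 δ q 0 - selmerLo m x0 δ q 0 := by
      simp only [selmerHi, selmerLo, if_true]
      have : 1 / (q + x0 1) - 1 / (q + x0 1 + δ) = δ / ((q + x0 1) * (q + x0 1 + δ)) := by
        field_simp; ring
      rw [this, sq]
      gcongr
      linarith
    have fs : ∀ i : Fin (m + 1),
        δ / (Q * κ) ≤ selmerHi m x0 δ q i.succ - selmerLo m x0 δ q i.succ := by
      intro i
      simp only [selmerHi, selmerLo, Fin.succ_ne_zero, if_false]
      set e := x0 i.succ.succ - x0 1 with he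
      have he1 : e ≤ 1 := by
        have : x0 i.succ.succ ≤ x0 (Fin.last (m + 2)) := hmono.monotone (Fin.le_last _)
        linarith
      have : (e + 2 * δ) / (q + x0 1 + δ) - e / (q + x0 1) =
          δ / (q + x0 1 + δ) + δ * (q + x0 1 - e) / ((q + x0 1) * (q + x0 1 + δ)) := by
        field_simp; ring
      rw [this]
      have t1 : δ / (Q * κ) ≤ δ / (q + x0 1 + δ) := by gcongr
      have t2 : 0 ≤ δ * (q + x0 1 - e) / ((q + x0 1) * (q + x0 1 + δ)) := by
        apply div_nonneg _ (by positivity)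
        apply mul_nonneg hδ.le; linarith
      linarith
    calc ENNReal.ofReal (c0 * ((Q : ℝ) ^ (m + 3))⁻¹)
        = ENNReal.ofReal (δ / (Q * κ) ^ 2) * ∏ i : Fin (m + 1), ENNReal.ofReal (δ / (Q * κ)) := by
          rw [Finset.prod_const, Finset.card_univ, Fintype.card_fin,
            ← ENNReal.ofReal_pow (by positivity), ← ENNReal.ofReal_mul (by positivity)]
          congr 1
          rw [hc0, div_pow]
          field_simp
          ring
      _ ≤ _ := by
          refine mul_le_mul' (ENNReal.ofReal_le_ofReal f0) (Finset.prod_le_prod' fun i _ => ?_)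
          exact ENNReal.ofReal_le_ofReal (fs i)
  have hdisj : Set.PairwiseDisjoint (↑(Finset.Ico Q (2 * Q))) box := by
    have key : ∀ q q' : ℕ, q < q' → Disjoint (box q) (box q') := by
      intro q q' hqq
      rw [Set.disjoint_left]
      intro u hu hu'
      have l := hu.1 0
      have r := hu'.2 0
      simp only [selmerLo, selmerHi, if_true] at l r
      have hq : (q : ℝ) + 1 ≤ q' := by exact_mod_cast hqq
      have hq0 : (0 : ℝ) ≤ q := by positivity
      have : 1 / ((q' : ℝ) + x0 1) < 1 / (q + x0 1 + δ) :=
        one_div_lt_one_div_of_lt (by linarith) (by linarith)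
      linarith
    intro q _ q' _ hne
    rcases lt_or_gt_of_ne hne with h | h
    · exact key q q' h
    · exact (key q' q h).symm
  have hsub : (⋃ q ∈ Finset.Ico Q (2 * Q), box q) ⊆ selmerChi m '' selmerGood m x0 ε Q := by
    intro u hu
    simp only [Set.mem_iUnion] at hu
    obtain ⟨q, hq, hu⟩ := hu
    exact selmer_box_sub x0 ε δ hδ hδε h1 hG Q q (Finset.mem_Ico.mp hq) u hu
  have hlow : ENNReal.ofReal (c0 * ((Q : ℝ) ^ (m + 2))⁻¹) ≤
      volume (selmerChi m '' selmerGood m x0 ε Q) := by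
    refine le_trans ?_ (measure_mono hsub)
    rw [measure_biUnion_finset hdisj (fun q _ => measurableSet_Icc)]
    refine le_trans ?_ (Finset.card_nsmul_le_sum _ _ _ hvol)
    rw [Nat.card_Ico, show 2 * Q - Q = Q by omega, nsmul_eq_mul, ← ENNReal.ofReal_natCast,
      ← ENNReal.ofReal_mul (by positivity)]
    apply le_of_eq
    congr 1
    field_simp
    ring
  have hup : volume (selmerChi m '' selmerGood m x0 ε Q) ≤
      ENNReal.ofReal M * μH[(m + 2 : ℝ)] (selmerGood m x0 ε Q) := by
    rw [← selmer_muH_eq]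
    refine ((hL.mono fun v hv => hv.1).hausdorffMeasure_image_le (by positivity)).trans ?_
    refine mul_le_mul' ?_ le_rfl
    have : (L : ℝ≥0∞) ^ ((m : ℝ) + 2) = ENNReal.ofReal ((L : ℝ) ^ (m + 2)) := by
      rw [ENNReal.ofReal_pow (by positivity), ENNReal.ofReal_coe_nnreal, ← ENNReal.rpow_natCast]
      push_cast; rfl
    rw [this]
    exact ENNReal.ofReal_le_ofReal (by linarith)
  have h := hlow.trans hup
  rw [div_mul_eq_mul_div, ENNReal.ofReal_div_of_pos hM0]
  exact ENNReal.div_le_of_le_mul' h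

end SelmerFinal

/-- Selmer algorithm satisfies Kerckhoff's balancedness condition: there exist `β ≥ 1`,
`K > 1` and `ρ ∈ (0,1)` such that, regardless of the past matrix `N` (any finite product
of `B₁` and `B₂`, including the identity), with conditional probability at least `ρ` the
matrix of induction becomes `β`-balanced before the largest column sum increases by a
factor of `K`. -/
theorem selmer_becomes_balanced (m : ℕ) :
    ∃ β K ρ : ℝ, 1 ≤ β ∧ 1 < K ∧ 0 < ρ ∧ ρ < 1 ∧
      ∀ N ∈ Submonoid.closure {selmerB1 m, selmerB2 m},
        ρ ≤ selmerCondP m N {v ∈ selmerSimplexE m | ∃ n : ℕ,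
          IsBalanced m β (N * selmerMat m v n) ∧
          colMax m (N * selmerMat m v n) ≤ K * colMax m N} := by
  obtain ⟨β, K, ε, x0, hβ, hK, hε, h1, hG, hdyn⟩ := selmer_dyn m
  obtain ⟨c1, hc1, hden⟩ := selmer_den m
  obtain ⟨c2, hc2, hnum⟩ := selmer_num m x0 ε hε h1 hG
  set R : ℝ := c2 * ((2 : ℝ) ^ (m + 3))⁻¹ / c1 with hR
  have hR0 : 0 < R := by positivity
  refine ⟨β, K, min R (1 / 2), hβ, hK, by positivity,
    lt_of_le_of_lt (min_le_right _ _) (by norm_num), fun N hN => ?_⟩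
  have hC := colSum_pos N hN
  set C := colSum m N with hCdef
  set A : ℝ := ∑ k : Fin (m + 2), C k.succ with hA
  have hA0 : 0 < A := Finset.sum_pos (fun k _ => hC _) Finset.univ_nonempty
  set Q : ℕ := ⌊C 0 / A⌋₊ + 1 with hQ
  have hQ1 : 1 ≤ Q := by omega
  have hQ0 : (0 : ℝ) < Q := by exact_mod_cast hQ1
  have hrQ : C 0 ≤ Q * A := by
    rw [← div_le_iff₀ hA0, hQ]; push_cast; exact (Nat.lt_floor_add_one _).le
  have hQr : Q * A ≤ C 0 + A := by
    have : (⌊C 0 / A⌋₊ : ℝ) ≤ C 0 / A := Nat.floor_le (div_nonneg (hC 0).le hA0.le)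
    rw [le_div_iff₀ hA0] at this
    rw [hQ]; push_cast; linarith
  set f : EuclideanSpace ℝ (Fin (m + 3)) → ℝ := fun v => ((∑ j, C j * v j) ^ (m + 3))⁻¹ with hf
  set X : ℝ := (A ^ (m + 3))⁻¹ * ((Q : ℝ) ^ (m + 2))⁻¹ with hX
  have hX0 : 0 < X := by positivity
  have hd := hden C A Q hC hA hQ1 hQr
  have hΩm : MeasurableSet (selmerSimplexE m) := selmerSimplexE_closed.measurableSet
  have hfm : Measurable f := by
    have : Measurable fun v : EuclideanSpace ℝ (Fin (m + 3)) => ∑ j, C j * v j := by fun_prop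
    exact (this.pow_const _).inv
  have hf0 : ∀ v ∈ selmerSimplexE m, 0 ≤ f v := by
    intro v hv
    have := (selmer_omega_facts v hv).1
    exact inv_nonneg.mpr (pow_nonneg (Finset.sum_nonneg fun j _ =>
      mul_nonneg (hC j).le (this j)) _)
  have hf0ae : ∀ᵐ v ∂(μH[(m + 2 : ℝ)].restrict (selmerSimplexE m)), 0 ≤ f v :=
    ae_restrict_of_forall_mem hΩm hf0
  have hfint : IntegrableOn f (selmerSimplexE m) μH[(m + 2 : ℝ)] := by
    refine ⟨hfm.aestronglyMeasurable, ?_⟩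
    rw [hasFiniteIntegral_iff_ofReal hf0ae]
    exact lt_of_le_of_lt hd ENNReal.ofReal_lt_top
  have hdenom : ∫ v in selmerSimplexE m, f v ∂(μH[(m + 2 : ℝ)]) ≤ c1 * X := by
    rw [integral_eq_lintegral_of_nonneg_ae hf0ae hfm.aestronglyMeasurable]
    exact ENNReal.toReal_le_of_le_ofReal (by positivity) hd
  set U : Set (EuclideanSpace ℝ (Fin (m + 3))) := {v ∈ selmerSimplexE m | ∃ n : ℕ,
          IsBalanced m β (N * selmerMat m v n) ∧
          colMax m (N * selmerMat m v n) ≤ K * colMax m N} with hU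
  have hUΩ : U ⊆ selmerSimplexE m := fun v hv => hv.1
  have hgood : ∀ v ∈ selmerGood m x0 ε Q, v ∈ U ∧ ((2 * A) ^ (m + 3))⁻¹ ≤ f v := by
    rintro v ⟨hv, hv0, q, ⟨hq1, hq2⟩, hclose⟩
    obtain ⟨f1, f2, f3⟩ := selmer_omega_facts v hv
    set x : Fin (m + 3) → ℝ := fun i => if i = 0 then 1 else v i / v 0 - q with hx
    have hxc : ∀ i, |x i - x0 i| ≤ ε := by
      intro i
      refine Fin.cases ?_ (fun i => ?_) i
      · simp [hx, h1]; exact hε.le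
      · simpa [hx] using hclose i
    have hqQ : (Q : ℝ) ≤ q := by exact_mod_cast hq1
    have hqQ2 : (q : ℝ) ≤ 2 * Q := by exact_mod_cast hq2.le
    have hvx : v.ofLp = selmerShift m q (v 0 • x) := by
      funext i
      by_cases hi : i = 0
      · simp [selmerShift, hi, hx]
      · simp only [selmerShift, hi, hx, if_false, if_true, Pi.smul_apply, smul_eq_mul]
        field_simp; ring
    constructor
    · refine ⟨hv, ?_⟩
      have := hdyn x q N (v 0) hv0 hxc hC (by
        rw [Fin.sum_univ_succ (n := m + 2)]
        change q * A ≤ 2 * (C 0 + A)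
        have : (q : ℝ) * A ≤ 2 * Q * A := by gcongr
        linarith)
      rw [← hvx] at this
      exact this
    · obtain ⟨k1, k2, k3⟩ := hG x hxc
      have k01 : x 0 < x 1 := k2 0
      simp only [hx, if_true, one_ne_zero, if_false] at k01
      have hv1 : (Q : ℝ) * v 0 ≤ 1 := by
        have : (Q : ℝ) ≤ v 1 / v 0 := by linarith
        rw [le_div_iff₀ hv0] at this
        linarith [f2 1]
      have hs : ∑ j, C j * v j ≤ 2 * A := by
        rw [Fin.sum_univ_succ]
        have a1 : ∑ i : Fin (m + 2), C i.succ * v i.succ ≤ A := by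
          rw [hA]
          refine Finset.sum_le_sum fun i _ => ?_
          exact mul_le_of_le_one_right (hC _).le (f2 _)
        have a2 : C 0 * v 0 ≤ Q * A * v 0 := mul_le_mul_of_nonneg_right hrQ hv0.le
        have a3 : A * (Q * v 0) ≤ A * 1 := mul_le_mul_of_nonneg_left hv1 hA0.le
        linarith
      have hs0 : 0 < ∑ j, C j * v j :=
        Finset.sum_pos' (fun j _ => mul_nonneg (hC j).le (f1 j))
          ⟨0, Finset.mem_univ _, mul_pos (hC 0) hv0⟩
      simp only [hf]
      gcongr
  have hgm := selmerGood_meas (m := m) x0 ε Q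
  have hgΩ : selmerGood m x0 ε Q ⊆ selmerSimplexE m := fun v hv => hv.1
  have hnumer : c2 * ((2 : ℝ) ^ (m + 3))⁻¹ * X ≤ ∫ v in U, f v ∂(μH[(m + 2 : ℝ)]) := by
    have s1 : ∫ v in selmerGood m x0 ε Q, f v ∂(μH[(m + 2 : ℝ)]) ≤
        ∫ v in U, f v ∂(μH[(m + 2 : ℝ)]) :=
      setIntegral_mono_set (hfint.mono_set hUΩ)
        (ae_restrict_of_ae_restrict_of_subset hUΩ hf0ae)
        (Filter.Eventually.of_forall fun v hv => (hgood v hv).1)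
    refine le_trans ?_ s1
    rw [integral_eq_lintegral_of_nonneg_ae (ae_restrict_of_ae_restrict_of_subset hgΩ hf0ae)
      hfm.aestronglyMeasurable]
    have hfin : ∫⁻ v in selmerGood m x0 ε Q, ENNReal.ofReal (f v) ∂(μH[(m + 2 : ℝ)]) ≠ ⊤ :=
      ((lintegral_mono_set hgΩ).trans_lt (lt_of_le_of_lt hd ENNReal.ofReal_lt_top)).ne
    refine (ENNReal.ofReal_le_iff_le_toReal hfin).mp ?_
    calc ENNReal.ofReal (c2 * ((2 : ℝ) ^ (m + 3))⁻¹ * X)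
        = ENNReal.ofReal (((2 * A) ^ (m + 3))⁻¹) *
          ENNReal.ofReal (c2 * ((Q : ℝ) ^ (m + 2))⁻¹) := by
          rw [← ENNReal.ofReal_mul (by positivity)]
          congr 1
          rw [hX, mul_pow, mul_inv]; ring
      _ ≤ ENNReal.ofReal (((2 * A) ^ (m + 3))⁻¹) * μH[(m + 2 : ℝ)] (selmerGood m x0 ε Q) :=
          mul_le_mul' le_rfl (hnum Q hQ1)
      _ = ∫⁻ v in selmerGood m x0 ε Q, ENNReal.ofReal (((2 * A) ^ (m + 3))⁻¹)
          ∂(μH[(m + 2 : ℝ)]) := (setLIntegral_const _ _).symm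
      _ ≤ _ := setLIntegral_mono' hgm fun v hv => ENNReal.ofReal_le_ofReal (hgood v hv).2
  have hle : ∫ v in U, f v ∂(μH[(m + 2 : ℝ)]) ≤
      ∫ v in selmerSimplexE m, f v ∂(μH[(m + 2 : ℝ)]) :=
    setIntegral_mono_set hfint hf0ae (Filter.Eventually.of_forall hUΩ)
  have hnpos : 0 < c2 * ((2 : ℝ) ^ (m + 3))⁻¹ * X := by positivity
  have hdpos : 0 < ∫ v in selmerSimplexE m, f v ∂(μH[(m + 2 : ℝ)]) := by linarith
  refine (min_le_left _ _).trans ?_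
  change R ≤ (∫ v in U, f v ∂(μH[(m + 2 : ℝ)])) /
    ∫ v in selmerSimplexE m, f v ∂(μH[(m + 2 : ℝ)])
  rw [le_div_iff₀ hdpos]
  refine le_trans (mul_le_mul_of_nonneg_left hdenom hR0.le) (le_trans (le_of_eq ?_) hnumer)
  rw [hR]
  field_simp
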